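/- Every heap H over a finite set P of pointer variables is homeomorphic to a heap K over P that has at most 2·|P| vertices. -/

import Mathlib

/-- A heap over pointer variables `P`: a finite set `V` of vertices (drawn from `ℕ`),
a partial successor function `succ` (with `succ v = none` outside `V`),
an edge-weight function `wt` (weights are at least 1 on actual edges),
and a labelling `L` of pointer variables by vertices. -/
structure Heap (P : Type) where
  V : Finset ℕ
  succ : ℕ → Option ℕ
  wt : ℕ → ℕ
  L : P → ℕ
  label_mem : ∀ p, L p ∈ V
  succ_mem : ∀ v ∈ V, ∀ u, succ v = some u → u ∈ V
  succ_dom : ∀ v, v ∉ V → succ v = none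
  wt_pos : ∀ v ∈ V, succ v ≠ none → 1 ≤ wt v

namespace Heap

variable {P : Type}

/-- `vs` is a walk from `x` to `y`: a nonempty list of vertices starting at `x`,
ending at `y`, where each vertex's successor is the next list element. -/
def IsWalk (H : Heap P) (x y : ℕ) (vs : List ℕ) : Prop :=
  vs.head? = some x ∧ vs.getLast? = some y ∧
    List.Chain' (fun a b => H.succ a = some b) vs

/-- The weight of a walk: the sum of the weights of its edges,
i.e. of `wt vᵢ` over all but the last vertex. -/
def walkWeight (H : Heap P) (vs : List ℕ) : ℕ :=
  (vs.dropLast.map H.wt).sum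

/-- `pathLength H x y ∈ ℕ ∪ {∞}`: the least weight of a walk from `x` to `y`,
and `∞` if there is no walk. -/
noncomputable def pathLength (H : Heap P) (x y : ℕ) : ℕ∞ :=
  sInf {n : ℕ∞ | ∃ vs : List ℕ, H.IsWalk x y vs ∧ n = (H.walkWeight vs : ℕ∞)}

/-- `x` lies on a cycle: there is a walk from `x` to `x` with at least one step. -/
def Circular (H : Heap P) (x : ℕ) : Prop :=
  ∃ vs : List ℕ, H.IsWalk x x vs ∧ 2 ≤ vs.length

/-- A vertex is reachable if some labelled vertex reaches it by following successors. -/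
def Reachable (H : Heap P) (v : ℕ) : Prop :=
  ∃ p : P, Relation.ReflTransGen (fun a b => H.succ a = some b) (H.L p) v

/-- `H'` is obtained from `H` by a single-edge subdivision: the edge from `u`
(with `succ u = some v` and weight `n ≥ 2`) is split, for some `1 ≤ k < n`, by a
fresh vertex `q` into an edge `u → q` of weight `k` and an edge `q → v` of weight
`n - k`; everything else is unchanged. -/
def SingleSubdiv (H H' : Heap P) : Prop :=
  ∃ u v q k : ℕ,
    u ∈ H.V ∧ H.succ u = some v ∧ 2 ≤ H.wt u ∧ 1 ≤ k ∧ k < H.wt u ∧ q ∉ H.V ∧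
    H'.V = insert q H.V ∧
    H'.succ = Function.update (Function.update H.succ u (some q)) q (some v) ∧
    H'.wt = Function.update (Function.update H.wt u k) q (H.wt u - k) ∧
    H'.L = H.L

/-- `H'` is a subdivision of `H`: it is obtained from `H` by a finite (possibly
empty) sequence of single-edge subdivisions. -/
def Subdiv (H H' : Heap P) : Prop :=
  Relation.ReflTransGen SingleSubdiv H H'

/-- Heap isomorphism: a bijection between the reachable vertices that respects
labels, successors and weights. -/
def Iso (H H' : Heap P) : Prop :=
  ∃ f : ℕ → ℕ,
    Set.BijOn f {v | H.Reachable v} {v | H'.Reachable v} ∧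
    (∀ p, f (H.L p) = H'.L p) ∧
    (∀ v, H.Reachable v → H'.succ (f v) = Option.map f (H.succ v)) ∧
    (∀ v, H.Reachable v → H.succ v ≠ none → H'.wt (f v) = H.wt v)

/-- Heap homeomorphism: some subdivision of `H` is isomorphic to some
subdivision of `H'`. -/
def Homeo (H H' : Heap P) : Prop :=
  ∃ S S' : Heap P, H.Subdiv S ∧ H'.Subdiv S' ∧ Iso S S'

/-- Successors of reachable vertices are reachable. -/
theorem Reachable.step {H : Heap P} {v w : ℕ} (hv : H.Reachable v) (h : H.succ v = some w) :
    H.Reachable w :=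
  let ⟨p, hp⟩ := hv
  ⟨p, hp.tail h⟩

theorem reachable_label (H : Heap P) (p : P) : H.Reachable (H.L p) :=
  ⟨p, .refl⟩

/-- Induction along the walks that start at labelled vertices. -/
theorem Reachable.rec_on {H : Heap P} {motive : ℕ → Prop} {v : ℕ} (hv : H.Reachable v)
    (label : ∀ p, motive (H.L p))
    (step : ∀ a b, motive a → H.succ a = some b → motive b) : motive v := by
  obtain ⟨p, hp⟩ := hv
  induction hp with
  | refl => exact label p
  | tail _ h ih => exact step _ _ ih h

theorem Reachable.mem {H : Heap P} {v : ℕ} (hv : H.Reachable v) : v ∈ H.V := by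
  refine hv.rec_on H.label_mem fun a b ha h => H.succ_mem a ha b h

theorem mem_of_succ_eq_some (H : Heap P) {v w : ℕ} (h : H.succ v = some w) : v ∈ H.V := by
  by_contra hv
  simp [H.succ_dom v hv] at h

open Classical in
/-- The subheap of reachable vertices. -/
noncomputable def restrict (H : Heap P) : Heap P where
  V := H.V.filter H.Reachable
  succ v := if H.Reachable v then H.succ v else none
  wt := H.wt
  L := H.L
  label_mem p := Finset.mem_filter.2 ⟨H.label_mem p, H.reachable_label p⟩
  succ_mem v hv u h := by
    have hr := (Finset.mem_filter.1 hv).2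
    rw [if_pos hr] at h
    exact Finset.mem_filter.2 ⟨(hr.step h).mem, hr.step h⟩
  succ_dom v hv := if_neg fun hr => hv (Finset.mem_filter.2 ⟨hr.mem, hr⟩)
  wt_pos v hv h := by
    have hr := (Finset.mem_filter.1 hv).2
    rw [if_pos hr] at h
    exact H.wt_pos v hr.mem h

theorem restrict_succ {H : Heap P} {v : ℕ} (hv : H.Reachable v) :
    H.restrict.succ v = H.succ v :=
  if_pos hv

theorem restrict_reachable_iff (H : Heap P) (v : ℕ) :
    H.restrict.Reachable v ↔ H.Reachable v := by
  constructor
  · intro hv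
    refine hv.rec_on H.reachable_label fun a b ha h => ?_
    rw [restrict_succ ha] at h
    exact ha.step h
  · intro hv
    refine (hv.rec_on (motive := fun x => H.Reachable x ∧ H.restrict.Reachable x)
      (fun p => ⟨H.reachable_label p, H.restrict.reachable_label p⟩) ?_).2
    rintro a b ⟨ha, ha'⟩ h
    exact ⟨ha.step h, ha'.step ((restrict_succ ha).trans h)⟩

theorem iso_restrict (H : Heap P) : Iso H H.restrict := by
  refine ⟨id, ?_, fun _ => rfl, fun v hv => ?_, fun _ _ _ => rfl⟩
  · simp only [restrict_reachable_iff]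
    exact Set.bijOn_id _
  · simpa using restrict_succ hv

theorem reachable_of_mem_restrict {H : Heap P} {v : ℕ} (hv : v ∈ H.restrict.V) :
    H.restrict.Reachable v := by
  classical
  exact (H.restrict_reachable_iff v).2 (Finset.mem_filter.1 hv).2

/-- Smoothing: bypass the unlabelled vertex `q`, whose unique predecessor is `u ≠ q` and whose
successor is `v`. -/
def smooth (H : Heap P) (u q v : ℕ) (hL : ∀ p, H.L p ≠ q) (huq : u ≠ q)
    (hu : H.succ u = some q) (hq : H.succ q = some v)
    (huniq : ∀ x, H.succ x = some q → x = u) : Heap P where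
  V := H.V.erase q
  succ := Function.update (Function.update H.succ u (some v)) q none
  wt := Function.update H.wt u (H.wt u + H.wt q)
  L := H.L
  label_mem p := Finset.mem_erase.2 ⟨hL p, H.label_mem p⟩
  succ_mem x hx y h := by
    have hvq : v ≠ q := fun e => huq (huniq q (e ▸ hq)).symm
    have hv : v ∈ H.V := H.succ_mem q (H.mem_of_succ_eq_some hq) v hq
    obtain ⟨hxq, hxV⟩ := Finset.mem_erase.1 hx
    rw [Function.update_of_ne hxq] at h
    by_cases hxu : x = u
    · subst hxu
      simp only [Function.update_self, Option.some.injEq] at h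
      exact h ▸ Finset.mem_erase.2 ⟨hvq, hv⟩
    · rw [Function.update_of_ne hxu] at h
      exact Finset.mem_erase.2 ⟨fun e => hxu (huniq x (e ▸ h)), H.succ_mem x hxV y h⟩
  succ_dom x hx := by
    by_cases hxq : x = q
    · subst hxq
      simp
    · have hxV : x ∉ H.V := fun h => hx (Finset.mem_erase.2 ⟨hxq, h⟩)
      have hxu : x ≠ u := fun e => hxV (e ▸ H.mem_of_succ_eq_some hu)
      rw [Function.update_of_ne hxq, Function.update_of_ne hxu, H.succ_dom x hxV]
  wt_pos x hx h := by
    obtain ⟨hxq, hxV⟩ := Finset.mem_erase.1 hx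
    by_cases hxu : x = u
    · subst hxu
      have := H.wt_pos x hxV (by simp [hu])
      simp only [Function.update_self]
      omega
    · rw [Function.update_of_ne hxq, Function.update_of_ne hxu] at h
      rw [Function.update_of_ne hxu]
      exact H.wt_pos x hxV h

section Smooth

variable (H : Heap P) (u q v : ℕ) (hL : ∀ p, H.L p ≠ q) (huq : u ≠ q)
  (hu : H.succ u = some q) (hq : H.succ q = some v) (huniq : ∀ x, H.succ x = some q → x = u)

theorem smooth_singleSubdiv : SingleSubdiv (H.smooth u q v hL huq hu hq huniq) H := by
  have huV := H.mem_of_succ_eq_some hu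
  have hqV := H.mem_of_succ_eq_some hq
  have hwu := H.wt_pos u huV (by simp [hu])
  have hwq := H.wt_pos q hqV (by simp [hq])
  refine ⟨u, v, q, H.wt u, Finset.mem_erase.2 ⟨huq, huV⟩, ?_, ?_, hwu, ?_,
    Finset.notMem_erase q _, (Finset.insert_erase hqV).symm, ?_, ?_, rfl⟩
  · simp [smooth, huq]
  · simp only [smooth, Function.update_self]
    omega
  · simp only [smooth, Function.update_self]
    omega
  · funext x
    by_cases hxq : x = q
    · subst hxq
      simp [hq]
    · by_cases hxu : x = u
      · subst hxu
        simp [hxq, hu]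
      · simp [smooth, hxq, hxu]
  · funext x
    by_cases hxq : x = q
    · subst hxq
      simp [smooth]
    · by_cases hxu : x = u
      · subst hxu
        simp [hxq]
      · simp [smooth, hxq]

theorem smooth_reachable {x : ℕ} (hx : H.Reachable x) (hxq : x ≠ q) :
    (H.smooth u q v hL huq hu hq huniq).Reachable x := by
  have key : (x ≠ q → (H.smooth u q v hL huq hu hq huniq).Reachable x) ∧
      (x = q → (H.smooth u q v hL huq hu hq huniq).Reachable u) := by
    refine hx.rec_on (motive := fun x =>
      (x ≠ q → (H.smooth u q v hL huq hu hq huniq).Reachable x) ∧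
        (x = q → (H.smooth u q v hL huq hu hq huniq).Reachable u))
      (fun p => ⟨fun _ => reachable_label _ p, fun e => absurd e (hL p)⟩) ?_
    rintro a b ⟨hne, heq⟩ h
    refine ⟨fun hb => ?_, fun hb => ?_⟩
    · by_cases haq : a = q
      · subst haq
        obtain rfl : v = b := Option.some.inj (hq.symm.trans h)
        exact (heq rfl).step (by simp [smooth, huq])
      · have hau : a ≠ u := by
          rintro rfl
          exact hb (Option.some.inj (h.symm.trans hu))
        exact (hne haq).step (by simp [smooth, haq, hau, h])
    · subst hb
      obtain rfl := huniq a h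
      exact hne huq
  exact key.1 hxq

end Smooth

/-- If each unlabelled vertex has two distinct preimages under the
successor map extended by the identity, then there are at most `2·|P|` vertices. -/
theorem card_le_of_two_le_card_fiber [Fintype P] (H : Heap P)
    (h : ∀ w ∈ H.V, (∀ p, H.L p ≠ w) →
      2 ≤ (H.V.filter fun x => (H.succ x).getD x = w).card) :
    H.V.card ≤ 2 * Fintype.card P := by
  classical
  have hmaps : ∀ x ∈ H.V, (H.succ x).getD x ∈ H.V := fun x hx => by
    cases hs : H.succ x with
    | none => simpa using hx
    | some y => simpa using H.succ_mem x hx y hs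
  have hL : (Finset.univ.image H.L).card ≤ Fintype.card P := Finset.card_image_le
  have hsplit := Finset.le_card_sdiff (Finset.univ.image H.L) H.V
  have hfib : 2 * (H.V \ Finset.univ.image H.L).card ≤ H.V.card := by
    rw [Finset.card_eq_sum_card_fiberwise hmaps, mul_comm, ← smul_eq_mul]
    refine (Finset.card_nsmul_le_sum _ _ _ fun w hw => ?_).trans
      (Finset.sum_le_sum_of_subset Finset.sdiff_subset)
    obtain ⟨hwV, hwL⟩ := Finset.mem_sdiff.1 hw
    exact h w hwV fun p hp => hwL (Finset.mem_image.2 ⟨p, Finset.mem_univ p, hp⟩)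
  omega

/-- A heap all of whose vertices are reachable is a subdivision of a heap with at most `2·|P|`
vertices. -/
theorem exists_subdiv_card_le [Fintype P] (H : Heap P) (hr : ∀ v ∈ H.V, H.Reachable v) :
    ∃ K : Heap P, K.Subdiv H ∧ K.V.card ≤ 2 * Fintype.card P := by
  induction hn : H.V.card using Nat.strong_induction_on generalizing H with
  | _ n ih =>
  subst hn
  by_cases h : ∀ w ∈ H.V, (∀ p, H.L p ≠ w) →
      2 ≤ (H.V.filter fun x => (H.succ x).getD x = w).card
  · exact ⟨H, .refl, H.card_le_of_two_le_card_fiber h⟩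
  · push Not at h
    obtain ⟨q, hqV, hL, hcard⟩ := h
    have hfib : ∀ x y, x ∈ H.V → y ∈ H.V → (H.succ x).getD x = q → (H.succ y).getD y = q →
        x = y := fun x y hx hy hxq hyq =>
      Finset.card_le_one.1 (Nat.lt_succ_iff.1 hcard) x (Finset.mem_filter.2 ⟨hx, hxq⟩)
        y (Finset.mem_filter.2 ⟨hy, hyq⟩)
    have huniq : ∀ x y, H.succ x = some q → H.succ y = some q → x = y := fun x y hx hy =>
      hfib x y (H.mem_of_succ_eq_some hx) (H.mem_of_succ_eq_some hy) (by simp [hx]) (by simp [hy])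
    obtain ⟨u, huq, hu⟩ : ∃ u, u ≠ q ∧ H.succ u = some q := by
      by_contra hno
      push Not at hno
      exact (hr q hqV).rec_on (motive := (· ≠ q)) hL
        (fun a b ha hab hb => hno a ha (hb ▸ hab)) rfl
    cases hq : H.succ q with
    | none =>
      exact absurd (hfib u q (H.mem_of_succ_eq_some hu) hqV (by simp [hu]) (by simp [hq])) huq
    | some v =>
      have hu' : ∀ x, H.succ x = some q → x = u := fun x hx => huniq x u hx hu
      obtain ⟨K, hK, hKcard⟩ := ih _ (Finset.card_erase_lt_of_mem hqV)
        (H.smooth u q v hL huq hu hq hu')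
        (fun x hx => H.smooth_reachable u q v hL huq hu hq hu'
          (hr x (Finset.mem_of_mem_erase hx)) (Finset.ne_of_mem_erase hx)) rfl
      exact ⟨K, hK.tail (H.smooth_singleSubdiv u q v hL huq hu hq hu'), hKcard⟩

end Heap

/-- Model-theoretic core of the Small Model Theorem: every heap over a finite
set `P` of pointer variables is homeomorphic to a heap with at most `2·|P|`
vertices. -/
theorem small_model {P : Type} [Fintype P] (H : Heap P) :
    ∃ K : Heap P, H.Homeo K ∧ K.V.card ≤ 2 * Fintype.card P := by
  obtain ⟨K, hK, hcard⟩ :=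
    H.restrict.exists_subdiv_card_le fun _ hv => Heap.reachable_of_mem_restrict hv
  exact ⟨K, ⟨H, H.restrict, .refl, hK, H.iso_restrict⟩, hcard⟩
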